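/- arXiv:1006.0220 — 4 statements merged into one kernel-verified Lean document; each statement's English description precedes it below -/
import Mathlib

section
/- Let Σ be a set of autoepistemic formulas. The map Λ ↦ SE(Λ) := {φ ∈ ℒae : Σ ∪ Λ ⊨_L φ} is a bijection between the Σ-full sets and the stable expansions of Σ; in particular, for every Σ-full set Λ and every autoepistemic formula φ, it holds that Σ ∪ Λ ⊨_L φ if and only if φ ∈ SE(Λ). -/
/-- Autoepistemic formulas: propositional variables, Boolean connectives
`⊤, ⊥, ¬, ∧, ∨, ⊕`, and the modal operator `L` (`box`). -/
inductive AE : Type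
  | var : ℕ → AE
  | top : AE
  | bot : AE
  | neg : AE → AE
  | conj : AE → AE → AE
  | disj : AE → AE → AE
  | xor : AE → AE → AE
  | box : AE → AE
  deriving DecidableEq

namespace AE

/-- Propositional evaluation of an autoepistemic formula, where `v` assigns
truth values to propositional variables and `w` assigns truth values to
`L`-prefixed formulas (which are treated as atoms). -/
def eval (v : ℕ → Bool) (w : AE → Bool) : AE → Bool
  | var n => v n
  | top => true
  | bot => false
  | neg φ => !(eval v w φ)
  | conj φ ψ => eval v w φ && eval v w ψ
  | disj φ ψ => eval v w φ || eval v w ψ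
  | xor φ ψ => (eval v w φ) != (eval v w ψ)
  | box φ => w φ

/-- Propositional consequence, treating `L`-prefixed formulas as atoms. -/
def entails (S : Set AE) (φ : AE) : Prop :=
  ∀ v w, (∀ ψ ∈ S, eval v w ψ = true) → eval v w φ = true

/-- Deductive closure. -/
def Th (S : Set AE) : Set AE := {φ | entails S φ}

/-- `Δ` is a stable expansion of `S` if `Δ = Th (S ∪ L(Δ) ∪ ¬L(Δᶜ))`. -/
def IsStableExpansion (S Δ : Set AE) : Prop :=
  Δ = Th (S ∪ (box '' Δ) ∪ ((fun φ => neg (box φ)) '' Δᶜ))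

/-- The set of subformulas of a formula (including the formula itself). -/
def subf : AE → Set AE
  | var n => {var n}
  | top => {top}
  | bot => {bot}
  | neg φ => insert (neg φ) (subf φ)
  | conj φ ψ => insert (conj φ ψ) (subf φ ∪ subf ψ)
  | disj φ ψ => insert (disj φ ψ) (subf φ ∪ subf ψ)
  | xor φ ψ => insert (xor φ ψ) (subf φ ∪ subf ψ)
  | box φ => insert (box φ) (subf φ)

/-- `SF^L(S)`: the `L`-prefixed subformulas of formulas in `S`. -/
def SFL (S : Set AE) : Set AE := {χ | (∃ φ ∈ S, χ ∈ subf φ) ∧ ∃ ψ, χ = box ψ}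

/-- `¬SF^L(S)`. -/
def negSFL (S : Set AE) : Set AE := neg '' SFL S

/-- `Λ` is an `S`-full set. -/
def IsFull (S Λ : Set AE) : Prop :=
  Λ ⊆ SFL S ∪ negSFL S ∧
  ∀ φ, box φ ∈ SFL S →
    (entails (S ∪ Λ) φ ↔ box φ ∈ Λ) ∧ (¬ entails (S ∪ Λ) φ ↔ neg (box φ) ∈ Λ)


/-- The arguments `χ` of the maximal `L`-prefixed quasi-atomic subformulas
`Lχ ∈ SF^q(φ)`. -/
def qsub : AE → List AE
  | var _ => []
  | top => []
  | bot => []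
  | neg φ => qsub φ
  | conj φ ψ => qsub φ ++ qsub ψ
  | disj φ ψ => qsub φ ++ qsub ψ
  | xor φ ψ => qsub φ ++ qsub ψ
  | box φ => [φ]

theorem sizeOf_lt_of_mem_qsub : ∀ {χ φ : AE}, χ ∈ qsub φ → sizeOf χ < sizeOf φ := by
  intro χ φ h
  induction φ with
  | var n => simp [qsub] at h
  | top => simp [qsub] at h
  | bot => simp [qsub] at h
  | neg ψ ih => simp only [qsub] at h; have := ih h; simp; omega
  | conj ψ₁ ψ₂ ih₁ ih₂ =>
      simp only [qsub, List.mem_append] at h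
      rcases h with h | h
      · have := ih₁ h; simp; omega
      · have := ih₂ h; simp; omega
  | disj ψ₁ ψ₂ ih₁ ih₂ =>
      simp only [qsub, List.mem_append] at h
      rcases h with h | h
      · have := ih₁ h; simp; omega
      · have := ih₂ h; simp; omega
  | xor ψ₁ ψ₂ ih₁ ih₂ =>
      simp only [qsub, List.mem_append] at h
      rcases h with h | h
      · have := ih₁ h; simp; omega
      · have := ih₂ h; simp; omega
  | box ψ ih =>
      simp only [qsub, List.mem_singleton] at h
      subst h; simp

/-- Niemelä's consequence relation `S ⊨_L φ`:
`S ⊨_L φ` iff `S ∪ SB(φ) ⊨ φ`, where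
`SB(φ) = {Lχ ∈ SF^q(φ) | S ⊨_L χ} ∪ {¬Lχ | Lχ ∈ SF^q(φ), S ⊭_L χ}`. -/
def modelsL (S : Set AE) (φ : AE) : Prop :=
  entails (S ∪ {ψ | ∃ χ, ∃ _h : χ ∈ qsub φ,
      (ψ = box χ ∧ modelsL S χ) ∨ (ψ = neg (box χ) ∧ ¬ modelsL S χ)}) φ
termination_by sizeOf φ
decreasing_by all_goals exact sizeOf_lt_of_mem_qsub ‹_›

/-- The stable expansion `SE(Λ)` corresponding to a full set `Λ`. -/
def SE (S Λ : Set AE) : Set AE := {φ | modelsL (S ∪ Λ) φ}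


theorem eval_congr {v : ℕ → Bool} {w w' : AE → Bool} {φ : AE}
    (h : ∀ χ ∈ qsub φ, w χ = w' χ) : eval v w φ = eval v w' φ := by
  induction φ with
  | var _ | top | bot => rfl
  | neg φ ih => simp only [eval, ih h]
  | conj φ ψ ih₁ ih₂ | disj φ ψ ih₁ ih₂ | xor φ ψ ih₁ ih₂ =>
    simp only [qsub, List.mem_append] at h
    simp only [eval, ih₁ fun χ hχ => h χ (Or.inl hχ), ih₂ fun χ hχ => h χ (Or.inr hχ)]
  | box φ => exact h φ (by simp [qsub])

theorem mem_subf_self (φ : AE) : φ ∈ subf φ := by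
  cases φ <;> simp [subf]

theorem subf_subset {φ ψ : AE} (h : ψ ∈ subf φ) : subf ψ ⊆ subf φ := by
  induction φ with
  | var _ | top | bot =>
    simp only [subf, Set.mem_singleton_iff] at h
    rw [h]
  | neg φ ih | box φ ih =>
    rcases h with rfl | h
    · rfl
    · exact (ih h).trans (Set.subset_insert _ _)
  | conj φ₁ φ₂ ih₁ ih₂ | disj φ₁ φ₂ ih₁ ih₂ | xor φ₁ φ₂ ih₁ ih₂ =>
    rcases h with rfl | h | h
    · rfl
    · exact (ih₁ h).trans (Set.subset_union_left.trans (Set.subset_insert _ _))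
    · exact (ih₂ h).trans (Set.subset_union_right.trans (Set.subset_insert _ _))

theorem box_mem_subf_of_mem_qsub {φ χ : AE} (h : χ ∈ qsub φ) : box χ ∈ subf φ := by
  induction φ with
  | var _ | top | bot => simp [qsub] at h
  | neg φ ih => exact Or.inr (ih h)
  | conj φ ψ ih₁ ih₂ | disj φ ψ ih₁ ih₂ | xor φ ψ ih₁ ih₂ =>
    rcases List.mem_append.1 h with h | h
    · exact Or.inr (Or.inl (ih₁ h))
    · exact Or.inr (Or.inr (ih₂ h))
  | box φ =>
    rw [List.mem_singleton.1 h]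
    exact mem_subf_self _

theorem box_mem_SFL_of_mem {S : Set AE} {φ χ : AE} (hφ : φ ∈ S) (h : χ ∈ qsub φ) :
    box χ ∈ SFL S :=
  ⟨⟨φ, hφ, box_mem_subf_of_mem_qsub h⟩, χ, rfl⟩

theorem box_mem_SFL_of_box_mem {S : Set AE} {φ χ : AE} (hφ : box φ ∈ SFL S) (h : χ ∈ qsub φ) :
    box χ ∈ SFL S := by
  obtain ⟨⟨ψ, hψ, hs⟩, -⟩ := hφ
  exact ⟨⟨ψ, hψ, subf_subset hs (Or.inr (box_mem_subf_of_mem_qsub h))⟩, χ, rfl⟩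

/-- The `L`-prefixed subformulas of `S` and their negations that are true when `L` is
interpreted as membership in `Δ`. -/
def beliefs (S Δ : Set AE) : Set AE :=
  {ψ | ∃ φ, box φ ∈ SFL S ∧ ((ψ = box φ ∧ φ ∈ Δ) ∨ (ψ = neg (box φ) ∧ φ ∉ Δ))}

open Classical in
/-- The interpretation of `L`-prefixed formulas as membership in `Δ`. -/
noncomputable def interp (Δ : Set AE) : AE → Bool := fun φ => decide (φ ∈ Δ)

/-- Consequence from `S` when `L` is interpreted as membership in `Δ`. -/
def entailsAt (S Δ : Set AE) (φ : AE) : Prop :=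
  ∀ v, (∀ ψ ∈ S, eval v (interp Δ) ψ = true) → eval v (interp Δ) φ = true

theorem beliefs_congr {S Δ Δ' : Set AE} (h : ∀ φ, box φ ∈ SFL S → (φ ∈ Δ ↔ φ ∈ Δ')) :
    beliefs S Δ = beliefs S Δ' := by
  ext ψ
  refine exists_congr fun φ => and_congr_right fun hφ => ?_
  rw [h φ hφ]

theorem box_mem_beliefs {S Δ : Set AE} {φ : AE} (h : box φ ∈ SFL S) :
    box φ ∈ beliefs S Δ ↔ φ ∈ Δ := by
  constructor
  · rintro ⟨χ, -, ⟨h, hχ⟩ | ⟨h, -⟩⟩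
    · rwa [box.inj h]
    · cases h
  · exact fun hφ => ⟨φ, h, Or.inl ⟨rfl, hφ⟩⟩

theorem neg_box_mem_beliefs {S Δ : Set AE} {φ : AE} (h : box φ ∈ SFL S) :
    neg (box φ) ∈ beliefs S Δ ↔ φ ∉ Δ := by
  constructor
  · rintro ⟨χ, -, ⟨h, -⟩ | ⟨h, hχ⟩⟩
    · cases h
    · rwa [box.inj (neg.inj h)]
  · exact fun hφ => ⟨φ, h, Or.inr ⟨rfl, hφ⟩⟩

theorem eval_beliefs {S Δ : Set AE} {v : ℕ → Bool} {w : AE → Bool} :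
    (∀ ψ ∈ beliefs S Δ, eval v w ψ = true) ↔ ∀ φ, box φ ∈ SFL S → w φ = interp Δ φ := by
  constructor
  · intro h φ hφ
    by_cases hd : φ ∈ Δ
    · simpa [interp, hd, eval] using h _ ((box_mem_beliefs hφ).2 hd)
    · simpa [interp, hd, eval] using h _ ((neg_box_mem_beliefs hφ).2 hd)
  · rintro h ψ ⟨φ, hφ, ⟨rfl, hd⟩ | ⟨rfl, hd⟩⟩ <;> simp [eval, h φ hφ, interp, hd]

/-- If `X` forces the `L`-atoms of `φ` to be interpreted by `Δ`, and is true under that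
interpretation, then consequence from `S`, the beliefs and `X` is consequence at `Δ`. -/
theorem entails_beliefs_iff {S Δ X : Set AE} {φ : AE}
    (hX : ∀ v, ∀ ψ ∈ X, eval v (interp Δ) ψ = true)
    (hφ : ∀ v w, (∀ ψ ∈ S ∪ beliefs S Δ ∪ X, eval v w ψ = true) →
      ∀ χ ∈ qsub φ, w χ = interp Δ χ) :
    entails (S ∪ beliefs S Δ ∪ X) φ ↔ entailsAt S Δ φ := by
  constructor
  · intro h v hv
    refine h v _ ?_
    rintro ψ ((hψ | hψ) | hψ)
    · exact hv ψ hψ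
    · exact eval_beliefs.2 (fun _ _ => rfl) ψ hψ
    · exact hX v ψ hψ
  · intro h v w hw
    rw [eval_congr (hφ v w hw)]
    refine h v fun ψ hψ => ?_
    have hb := eval_beliefs.1 fun ψ hψ => hw ψ (Or.inl (Or.inr hψ))
    rw [← eval_congr fun χ hχ => hb χ (box_mem_SFL_of_mem hψ hχ)]
    exact hw ψ (Or.inl (Or.inl hψ))

theorem entails_beliefs_iff_of_box_mem {S Δ : Set AE} {φ : AE} (h : box φ ∈ SFL S) :
    entails (S ∪ beliefs S Δ) φ ↔ entailsAt S Δ φ := by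
  rw [← Set.union_empty (S ∪ beliefs S Δ)]
  refine entails_beliefs_iff (by simp) fun v w hw χ hχ => ?_
  exact eval_beliefs.1 (fun ψ hψ => hw ψ (Or.inl (Or.inr hψ))) χ (box_mem_SFL_of_box_mem h hχ)

theorem modelsL_beliefs_iff {S Δ : Set AE} {φ : AE}
    (h : ∀ χ ∈ qsub φ, (modelsL (S ∪ beliefs S Δ) χ ↔ χ ∈ Δ)) :
    modelsL (S ∪ beliefs S Δ) φ ↔ entailsAt S Δ φ := by
  rw [modelsL]
  refine entails_beliefs_iff ?_ fun v w hw χ hχ => ?_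
  · rintro v ψ ⟨χ, hχ, ⟨rfl, hm⟩ | ⟨rfl, hm⟩⟩ <;> rw [h χ hχ] at hm <;> simp [eval, interp, hm]
  · by_cases hd : χ ∈ Δ
    · simpa [interp, hd, eval] using
        hw (box χ) (Or.inr ⟨χ, hχ, Or.inl ⟨rfl, (h χ hχ).2 hd⟩⟩)
    · simpa [interp, hd, eval] using
        hw (neg (box χ)) (Or.inr ⟨χ, hχ, Or.inr ⟨rfl, mt (h χ hχ).1 hd⟩⟩)

theorem isStableExpansion_iff {S Δ : Set AE} :
    IsStableExpansion S Δ ↔ ∀ φ, φ ∈ Δ ↔ entailsAt S Δ φ := by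
  rw [IsStableExpansion, Set.ext_iff]
  refine forall_congr' fun φ => iff_congr Iff.rfl ⟨fun h v hv => h v _ ?_, fun h v w hw => ?_⟩
  · rintro ψ ((hψ | ⟨χ, hχ, rfl⟩) | ⟨χ, hχ, rfl⟩)
    · exact hv ψ hψ
    · simpa [eval, interp] using hχ
    · simpa [eval, interp] using hχ
  · obtain rfl : w = interp Δ := by
      funext χ
      by_cases hd : χ ∈ Δ
      · simpa [interp, hd, eval] using hw (box χ) (Or.inl (Or.inr ⟨χ, hd, rfl⟩))
      · simpa [interp, hd, eval] using hw (neg (box χ)) (Or.inr ⟨χ, hd, rfl⟩)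
    exact h v fun ψ hψ => hw ψ (Or.inl (Or.inl hψ))

theorem isFull_iff {S Λ : Set AE} :
    IsFull S Λ ↔ Λ = beliefs S {φ | entails (S ∪ Λ) φ} := by
  constructor
  · rintro ⟨hsub, h⟩
    ext ψ
    constructor
    · intro hψ
      rcases hsub hψ with hs | ⟨χ, hs, rfl⟩
      · obtain ⟨φ, rfl⟩ := hs.2
        exact (box_mem_beliefs hs).2 ((h φ hs).1.2 hψ)
      · obtain ⟨φ, rfl⟩ := hs.2
        exact (neg_box_mem_beliefs hs).2 ((h φ hs).2.2 hψ)
    · rintro ⟨φ, hs, ⟨rfl, hd⟩ | ⟨rfl, hd⟩⟩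
      · exact (h φ hs).1.1 hd
      · exact (h φ hs).2.1 hd
  · intro h
    refine ⟨?_, fun φ hφ => ?_⟩
    · rw [h]
      rintro ψ ⟨φ, hs, ⟨rfl, -⟩ | ⟨rfl, -⟩⟩
      · exact Or.inl hs
      · exact Or.inr ⟨_, hs, rfl⟩
    · generalize hΔ : {φ | entails (S ∪ Λ) φ} = Δ at h
      have hm : entails (S ∪ Λ) φ ↔ φ ∈ Δ := by rw [← hΔ]; rfl
      rw [hm, h]
      exact ⟨(box_mem_beliefs hφ).symm, (neg_box_mem_beliefs hφ).symm⟩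

theorem IsFull.modelsL_iff_entails {S Λ : Set AE} (h : IsFull S Λ) (φ : AE)
    (hφ : box φ ∈ SFL S) : modelsL (S ∪ Λ) φ ↔ entails (S ∪ Λ) φ := by
  have hΛ := isFull_iff.1 h
  generalize hΔ : {φ | entails (S ∪ Λ) φ} = Δ at hΛ
  have hm : ∀ φ, φ ∈ Δ ↔ entails (S ∪ Λ) φ := fun φ => by rw [← hΔ]; rfl
  have ih : ∀ χ ∈ qsub φ, (modelsL (S ∪ Λ) χ ↔ χ ∈ Δ) := fun χ hχ =>
    (h.modelsL_iff_entails χ (box_mem_SFL_of_box_mem hφ hχ)).trans (hm χ).symm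
  rw [hΛ] at ih ⊢
  rw [modelsL_beliefs_iff ih, entails_beliefs_iff_of_box_mem hφ]
termination_by sizeOf φ
decreasing_by exact sizeOf_lt_of_mem_qsub hχ

theorem IsFull.eq_beliefs_SE {S Λ : Set AE} (h : IsFull S Λ) : Λ = beliefs S (SE S Λ) :=
  (isFull_iff.1 h).trans (beliefs_congr fun φ hφ => (h.modelsL_iff_entails φ hφ).symm)

theorem IsFull.isStableExpansion_SE {S Λ : Set AE} (h : IsFull S Λ) :
    IsStableExpansion S (SE S Λ) := by
  have hΛ := h.eq_beliefs_SE
  generalize hΔ : SE S Λ = Δ at hΛ ⊢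
  have hm : ∀ φ, modelsL (S ∪ Λ) φ ↔ φ ∈ Δ := fun φ => by rw [← hΔ]; rfl
  rw [hΛ] at hm
  exact isStableExpansion_iff.2 fun φ =>
    (hm φ).symm.trans (modelsL_beliefs_iff fun χ _ => hm χ)

theorem IsStableExpansion.isFull_beliefs {S Δ : Set AE} (h : IsStableExpansion S Δ) :
    IsFull S (beliefs S Δ) :=
  isFull_iff.2 <| beliefs_congr fun φ hφ =>
    (isStableExpansion_iff.1 h φ).trans (entails_beliefs_iff_of_box_mem hφ).symm

theorem IsStableExpansion.modelsL_beliefs {S Δ : Set AE} (h : IsStableExpansion S Δ) (φ : AE) :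
    modelsL (S ∪ beliefs S Δ) φ ↔ φ ∈ Δ :=
  (modelsL_beliefs_iff fun χ _ => h.modelsL_beliefs χ).trans (isStableExpansion_iff.1 h φ).symm
termination_by sizeOf φ
decreasing_by exact sizeOf_lt_of_mem_qsub ‹_›

/-- The map `Λ ↦ SE(Λ) = {φ | Σ ∪ Λ ⊨_L φ}` is a bijection between the
`Σ`-full sets and the stable expansions of `Σ`; in particular, for every
`Σ`-full set `Λ` and every formula `φ`, `Σ ∪ Λ ⊨_L φ` iff `φ ∈ SE(Λ)`. -/
theorem full_sets_biject_with_stable_expansions (S : Set AE) :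
    Set.BijOn (SE S) {Λ | IsFull S Λ} {Δ | IsStableExpansion S Δ} ∧
    ∀ Λ : Set AE, IsFull S Λ → ∀ φ : AE, (modelsL (S ∪ Λ) φ ↔ φ ∈ SE S Λ) := by
  refine ⟨⟨fun Λ hΛ => hΛ.isStableExpansion_SE, fun Λ hΛ Λ' hΛ' heq => ?_, fun Δ hΔ => ?_⟩,
    fun _ _ _ => Iff.rfl⟩
  · rw [hΛ.eq_beliefs_SE, hΛ'.eq_beliefs_SE, heq]
  · exact ⟨beliefs S Δ, hΔ.isFull_beliefs, Set.ext hΔ.modelsL_beliefs⟩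

end AE
end

section
/- Let ψ be a propositional formula in disjunctive normal form over the variables x₁,…,xₙ,y₁,…,yₘ, let ψ' := ψ[¬x₁/x₁',…,¬xₙ/xₙ',¬y₁/y₁',…,¬yₘ/yₘ'] be obtained by replacing every negated variable by a corresponding fresh primed variable, and let Σ' := {Lψ'} ∪ {xᵢ ∨ Lxᵢ', Lxᵢ ∨ xᵢ' : 1 ≤ i ≤ n} ∪ {yⱼ ∨ yⱼ' : 1 ≤ j ≤ m}. Then every Σ'-full set Λ contains, for each 1 ≤ i ≤ n, exactly one of Lxᵢ and Lxᵢ' (that is, either Lxᵢ ∈ Λ and ¬Lxᵢ' ∈ Λ, or ¬Lxᵢ ∈ Λ and Lxᵢ' ∈ Λ). -/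
namespace AE

/-- A literal over `x`-variables (`Fin n`) and `y`-variables (`Fin m`):
a variable together with a polarity (`true` = positive). -/
abbrev Lit (n m : ℕ) := (Fin n ⊕ Fin m) × Bool

/-- A formula in disjunctive normal form: a disjunction (list) of terms,
each a conjunction (list) of literals. -/
abbrev DNF (n m : ℕ) := List (List (Lit n m))

/-- Evaluation of a literal under assignments `σ` (to the `x`s) and `τ` (to the `y`s). -/
def evalLit {n m : ℕ} (σ : Fin n → Bool) (τ : Fin m → Bool) : Lit n m → Bool
  | (Sum.inl i, b) => σ i == b
  | (Sum.inr j, b) => τ j == b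

/-- Evaluation of a DNF formula. -/
def evalDNF {n m : ℕ} (σ : Fin n → Bool) (τ : Fin m → Bool) (ψ : DNF n m) : Bool :=
  ψ.any fun tm => tm.all (evalLit σ τ)

/-- Translation of a literal into an autoepistemic formula, where a negative
literal `¬z` is replaced by the corresponding fresh primed variable `z'`:
`u` gives the names of the unprimed variables and `p` those of the primed ones. -/
def litForm {n m : ℕ} (u p : Fin n ⊕ Fin m → ℕ) : Lit n m → AE
  | (z, true) => var (u z)
  | (z, false) => var (p z)

/-- The formula `ψ'` obtained from the DNF `ψ` by replacing every negated
variable with its primed copy. -/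
def dnfForm {n m : ℕ} (u p : Fin n ⊕ Fin m → ℕ) (ψ : DNF n m) : AE :=
  (ψ.map fun tm => (tm.map (litForm u p)).foldr conj top).foldr disj bot

/-- The set `Σ' = {Lψ'} ∪ {xᵢ ∨ Lxᵢ', Lxᵢ ∨ xᵢ' : i} ∪ {yⱼ ∨ yⱼ' : j}`. -/
def sigmaDNF {n m : ℕ} (u p : Fin n ⊕ Fin m → ℕ) (ψ : DNF n m) : Set AE :=
  {box (dnfForm u p ψ)} ∪
  {φ | ∃ i : Fin n, φ = disj (var (u (Sum.inl i))) (box (var (p (Sum.inl i))))} ∪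
  {φ | ∃ i : Fin n, φ = disj (box (var (u (Sum.inl i)))) (var (p (Sum.inl i)))} ∪
  {φ | ∃ j : Fin m, φ = disj (var (u (Sum.inr j))) (var (p (Sum.inr j)))}

theorem box_mem_SFL {S : Set AE} {φ χ : AE} (hχ : χ ∈ S) (h : box φ ∈ subf χ) :
    box φ ∈ SFL S :=
  ⟨⟨χ, hχ, h⟩, φ, rfl⟩

/-- For a full set, every `L`-prefixed formula that is itself a premise belongs to the set. -/
theorem IsFull.box_mem_of_mem {S Λ : Set AE} (h : IsFull S Λ) {φ : AE} (hφ : box φ ∈ S) :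
    box φ ∈ Λ := by
  obtain ⟨h₁, h₂⟩ := h.2 φ (box_mem_SFL hφ (by simp [subf]))
  by_contra hn
  refine hn (h₁.1 fun v w hvw => ?_)
  have hpos := hvw _ (Or.inl hφ)
  have hneg := hvw _ (Or.inr (h₂.1 fun he => hn (h₁.1 he)))
  simp_all [eval]

/-- The truth assignment reading the `L`-atoms off a full set satisfies that set. -/
theorem IsFull.eval_eq_true {S Λ : Set AE} (h : IsFull S Λ) {w : AE → Bool}
    (hw : ∀ φ, w φ = true ↔ box φ ∈ Λ) (v : ℕ → Bool) {χ : AE} (hχ : χ ∈ Λ) :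
    eval v w χ = true := by
  rcases h.1 hχ with ⟨-, φ, rfl⟩ | ⟨_, ⟨hsub, φ, rfl⟩, rfl⟩
  · exact (hw _).2 hχ
  · obtain ⟨h₁, h₂⟩ := h.2 φ ⟨hsub, φ, rfl⟩
    have hn : box φ ∉ Λ := fun hb => h₂.2 hχ (h₁.2 hb)
    simpa [eval, ← hw] using hn

/-- Every `Σ'`-full set `Λ` contains, for each `i`, exactly one of `Lxᵢ` and
`Lxᵢ'`: either `Lxᵢ ∈ Λ` and `¬Lxᵢ' ∈ Λ`, or `¬Lxᵢ ∈ Λ` and `Lxᵢ' ∈ Λ`. -/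
theorem full_set_chooses_one (n m : ℕ) (u p : Fin n ⊕ Fin m → ℕ)
    (hinj : Function.Injective (Sum.elim u p : (Fin n ⊕ Fin m) ⊕ (Fin n ⊕ Fin m) → ℕ))
    (ψ : DNF n m) (Λ : Set AE) (hfull : IsFull (sigmaDNF u p ψ) Λ) :
    ∀ i : Fin n,
      (box (var (u (Sum.inl i))) ∈ Λ ∧ neg (box (var (p (Sum.inl i)))) ∈ Λ) ∨
      (neg (box (var (u (Sum.inl i)))) ∈ Λ ∧ box (var (p (Sum.inl i))) ∈ Λ) := by
  classical
  intro i
  have hx := hfull.2 (var (u (Sum.inl i)))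
    (box_mem_SFL (χ := disj (box (var (u (Sum.inl i)))) (var (p (Sum.inl i))))
      (Or.inl (Or.inr ⟨i, rfl⟩)) (by simp [subf]))
  have hx' := hfull.2 (var (p (Sum.inl i)))
    (box_mem_SFL (χ := disj (var (u (Sum.inl i))) (box (var (p (Sum.inl i)))))
      (Or.inl (Or.inl (Or.inr ⟨i, rfl⟩))) (by simp [subf]))
  have not_both : ¬ (box (var (u (Sum.inl i))) ∈ Λ ∧ box (var (p (Sum.inl i))) ∈ Λ) := by
    rintro ⟨hbu, hbp⟩
    have hu : ∀ z, z ≠ Sum.inl i → u z ≠ u (Sum.inl i) := fun z hz he =>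
      hz (Sum.inl_injective (hinj (a₁ := Sum.inl z) (a₂ := Sum.inl (Sum.inl i)) he))
    have hp : ∀ z, p z ≠ u (Sum.inl i) := fun z he =>
      Sum.inr_ne_inl (hinj (a₁ := Sum.inr z) (a₂ := Sum.inl (Sum.inl i)) he)
    have hw : ∀ φ, decide (box φ ∈ Λ) = true ↔ box φ ∈ Λ := fun φ => decide_eq_true_iff
    have hfalse := hx.1.2 hbu (fun k => decide (k ≠ u (Sum.inl i)))
      (fun φ => decide (box φ ∈ Λ)) ?_
    · simp [eval] at hfalse
    · rintro χ (hχ | hχ)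
      · rcases hχ with ((rfl | ⟨k, rfl⟩) | ⟨k, rfl⟩) | ⟨j, rfl⟩
        · exact (hw _).2 (hfull.box_mem_of_mem (Or.inl (Or.inl (Or.inl rfl))))
        · by_cases hk : k = i
          · subst hk
            simp [eval, hbp]
          · simp [eval, hu (Sum.inl k) (by simpa using hk)]
        · simp [eval, hp]
        · simp [eval, hp]
      · exact hfull.eval_eq_true hw _ hχ
  have not_neither : entails (sigmaDNF u p ψ ∪ Λ) (var (u (Sum.inl i))) ∨
      entails (sigmaDNF u p ψ ∪ Λ) (var (p (Sum.inl i))) := by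
    by_contra! hn
    refine hn.1 fun v w hvw => ?_
    have hdisj := hvw (disj (var (u (Sum.inl i))) (box (var (p (Sum.inl i)))))
      (Or.inl (Or.inl (Or.inl (Or.inr ⟨i, rfl⟩))))
    have hneg := hvw _ (Or.inr (hx'.2.1 hn.2))
    simp_all [eval]
  tauto

end AE
end

section
/- Let ψ be a propositional formula in disjunctive normal form over the variables x₁,…,xₙ,y₁,…,yₘ, let ψ' := ψ[¬x₁/x₁',…,¬xₙ/xₙ',¬y₁/y₁',…,¬yₘ/yₘ'] be obtained by replacing every negated variable by a corresponding fresh primed variable, and let Σ' := {Lψ'} ∪ {xᵢ ∨ Lxᵢ', Lxᵢ ∨ xᵢ' : 1 ≤ i ≤ n} ∪ {yⱼ ∨ yⱼ' : 1 ≤ j ≤ m}. Then Σ' has a stable expansion if and only if the quantified Boolean formula ∃x₁⋯∃xₙ∀y₁⋯∀yₘ ψ is true, i.e., if and only if there exists a truth assignment σ to x₁,…,xₙ such that every extension of σ to y₁,…,yₘ satisfies ψ. -/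
namespace AE

theorem isStableExpansion_setOf_iff (S : Set AE) (w : AE → Bool) :
    IsStableExpansion S {φ | w φ = true} ↔
      ∀ φ, w φ = true ↔
        ∀ v, (∀ ψ ∈ S, eval v w ψ = true) → eval v w φ = true := by
  have models : ∀ v w',
      (∀ ψ ∈ S ∪ (box '' {φ | w φ = true}) ∪
        ((fun φ => neg (box φ)) '' {φ | w φ = true}ᶜ), eval v w' ψ = true) ↔
        w' = w ∧ ∀ ψ ∈ S, eval v w ψ = true := by
    intro v w'
    constructor
    · intro h
      have hw : w' = w := by
        funext φ
        cases hφ : w φ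
        · simpa [eval] using h (neg (box φ)) (Or.inr ⟨φ, by simp [hφ], rfl⟩)
        · simpa [eval] using h (box φ) (Or.inl (Or.inr ⟨φ, hφ, rfl⟩))
      subst hw
      exact ⟨rfl, fun ψ hψ => h ψ (Or.inl (Or.inl hψ))⟩
    · rintro ⟨rfl, h⟩ ψ ((hψ | ⟨φ, hφ, rfl⟩) | ⟨φ, hφ, rfl⟩)
      · exact h ψ hψ
      · simpa [eval] using hφ
      · simpa [eval] using hφ
  simp only [IsStableExpansion, Th, entails, models, Set.ext_iff, Set.mem_ofPred_eq]
  refine forall_congr' fun φ => iff_congr Iff.rfl ⟨fun h v hv => h v w ⟨rfl, hv⟩, ?_⟩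
  rintro h v _ ⟨rfl, hv⟩
  exact h v hv

theorem exists_isStableExpansion_iff (S : Set AE) :
    (∃ Δ, IsStableExpansion S Δ) ↔
      ∃ w : AE → Bool, ∀ φ, w φ = true ↔
        ∀ v, (∀ ψ ∈ S, eval v w ψ = true) → eval v w φ = true := by
  classical
  constructor
  · rintro ⟨Δ, hΔ⟩
    refine ⟨fun φ => decide (φ ∈ Δ), (isStableExpansion_setOf_iff S _).1 ?_⟩
    simpa using hΔ
  · rintro ⟨w, hw⟩
    exact ⟨_, (isStableExpansion_setOf_iff S w).2 hw⟩

/-- Evaluation in the S5 model whose set of worlds is `K`. -/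
noncomputable def evalS5 (K : Set (ℕ → Bool)) : AE → (ℕ → Bool) → Bool
  | var n, v => v n
  | top, _ => true
  | bot, _ => false
  | neg φ, v => !(evalS5 K φ v)
  | conj φ ψ, v => evalS5 K φ v && evalS5 K ψ v
  | disj φ ψ, v => evalS5 K φ v || evalS5 K ψ v
  | xor φ ψ, v => (evalS5 K φ v) != (evalS5 K ψ v)
  | box φ, _ => @decide (∀ v ∈ K, evalS5 K φ v = true) (Classical.dec _)

theorem exists_box_valuation (K : Set (ℕ → Bool)) :
    ∃ w : AE → Bool, ∀ φ, w φ = true ↔ ∀ v ∈ K, eval v w φ = true := by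
  let w : AE → Bool := fun φ => evalS5 K (box φ) fun _ => true
  have eval_eq : ∀ φ v, eval v w φ = evalS5 K φ v := by
    intro φ v
    induction φ with
    | box φ => rfl
    | _ => simp_all [eval, evalS5]
  refine ⟨w, fun φ => ?_⟩
  simp only [eval_eq]
  simp [w, evalS5]

/-- The assignments satisfying the disjunctive members of `sigmaDNF` when `a i` and `b i` are the
truth values of the boxed `i`-th unprimed and primed `x`-variable. -/
def admissible {n m : ℕ} (u p : Fin n ⊕ Fin m → ℕ) (a b : Fin n → Bool) : Set (ℕ → Bool) :=
  {v | (∀ i, v (u (Sum.inl i)) = true ∨ b i = true) ∧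
    (∀ i, a i = true ∨ v (p (Sum.inl i)) = true) ∧
    ∀ j, v (u (Sum.inr j)) = true ∨ v (p (Sum.inr j)) = true}

section

variable {n m : ℕ} {u p : Fin n ⊕ Fin m → ℕ}

theorem models_sigmaDNF_iff (ψ : DNF n m) (v : ℕ → Bool) (w : AE → Bool) :
    (∀ φ ∈ sigmaDNF u p ψ, eval v w φ = true) ↔
      w (dnfForm u p ψ) = true ∧
        v ∈ admissible u p (fun i => w (var (u (Sum.inl i)))) fun i => w (var (p (Sum.inl i))) := by
  simp only [sigmaDNF, admissible, Set.mem_union, Set.mem_singleton_iff, Set.mem_ofPred_eq,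
    or_imp, forall_and, forall_exists_index, forall_eq, eval, and_assoc]
  refine and_congr Iff.rfl (and_congr ?_ (and_congr ?_ ?_)) <;>
    rw [forall_comm] <;> simp [eval]

theorem eval_dnfForm (ψ : DNF n m) (v : ℕ → Bool) (w : AE → Bool) :
    eval v w (dnfForm u p ψ) = ψ.any fun tm => tm.all fun l => eval v w (litForm u p l) := by
  have term : ∀ tm : List (Lit n m), eval v w ((tm.map (litForm u p)).foldr conj top) =
      tm.all fun l => eval v w (litForm u p l) := by
    intro tm
    induction tm with
    | nil => rfl
    | cons l tm ih => simp only [List.map_cons, List.foldr_cons, eval, ih, List.all_cons]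
  unfold dnfForm
  induction ψ with
  | nil => rfl
  | cons tm ψ ih => simp only [List.map_cons, List.foldr_cons, eval, ih, term, List.any_cons]

theorem forall_admissible_pos_iff
    (hinj : Function.Injective (Sum.elim u p : (Fin n ⊕ Fin m) ⊕ (Fin n ⊕ Fin m) → ℕ))
    (a b : Fin n → Bool) (i : Fin n) :
    (∀ v ∈ admissible u p a b, v (u (Sum.inl i)) = true) ↔ b i = false := by
  have hu : ∀ z z', u z = u z' ↔ z = z' := fun z z' => by
    simpa using hinj.eq_iff (a := Sum.inl z) (b := Sum.inl z')
  have hpu : ∀ z z', p z ≠ u z' := fun z z' h => by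
    simpa using @hinj (Sum.inr z) (Sum.inl z') h
  constructor
  · intro h
    by_contra hb
    have := h (fun k => decide (k ≠ u (Sum.inl i))) ⟨fun i' => ?_, fun i' => ?_, fun j => ?_⟩
    · simp at this
    · rcases eq_or_ne i' i with rfl | hi
      · exact Or.inr (by simpa using hb)
      · exact Or.inl (by simpa [hu] using hi)
    · exact Or.inr (by simp [hpu])
    · exact Or.inr (by simp [hpu])
  · intro hb v hv
    simpa [hb] using hv.1 i

theorem forall_admissible_neg_iff
    (hinj : Function.Injective (Sum.elim u p : (Fin n ⊕ Fin m) ⊕ (Fin n ⊕ Fin m) → ℕ))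
    (a b : Fin n → Bool) (i : Fin n) :
    (∀ v ∈ admissible u p a b, v (p (Sum.inl i)) = true) ↔ a i = false := by
  have swap : admissible u p a b = admissible p u b a := by
    ext v
    simp only [admissible, Set.mem_ofPred_eq]
    constructor <;> rintro ⟨h₁, h₂, h₃⟩ <;>
      exact ⟨fun i => (h₂ i).symm, fun i => (h₁ i).symm, fun j => (h₃ j).symm⟩
  rw [swap]
  refine forall_admissible_pos_iff ?_ b a i
  convert hinj.comp (Equiv.sumComm _ _).injective using 1
  ext (z | z) <;> rfl

theorem exists_literal_valuation
    (hinj : Function.Injective (Sum.elim u p : (Fin n ⊕ Fin m) ⊕ (Fin n ⊕ Fin m) → ℕ))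
    (σ : Fin n → Bool) (τ : Fin m → Bool) :
    ∃ v : ℕ → Bool, v ∈ admissible u p σ (fun i => !σ i) ∧
      ∀ w l, eval v w (litForm u p l) = evalLit σ τ l := by
  let s : Fin n ⊕ Fin m → Bool := Sum.elim σ τ
  obtain ⟨v, hv⟩ : ∃ v : ℕ → Bool, ∀ z, v (Sum.elim u p z) = Sum.elim s (fun z => !s z) z :=
    ⟨Function.extend (Sum.elim u p) (Sum.elim s fun z => !s z) fun _ => true,
      fun z => hinj.extend_apply _ _ z⟩
  have hu : ∀ z, v (u z) = s z := fun z => hv (Sum.inl z)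
  have hp : ∀ z, v (p z) = !s z := fun z => hv (Sum.inr z)
  refine ⟨v, ⟨fun i => ?_, fun i => ?_, fun j => ?_⟩, ?_⟩
  · cases h : σ i <;> simp [hu, s, h]
  · cases h : σ i <;> simp [hp, s, h]
  · cases h : τ j <;> simp [hu, hp, s, h]
  · rintro w ⟨i | j, _ | _⟩ <;> simp [litForm, eval, evalLit, hu, hp, s]

theorem eval_dnfForm_of_admissible {σ : Fin n → Bool} {v : ℕ → Bool}
    (hv : v ∈ admissible u p σ fun i => !σ i) (w : AE → Bool) {ψ : DNF n m}
    (hψ : evalDNF σ (fun j => v (u (Sum.inr j))) ψ = true) :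
    eval v w (dnfForm u p ψ) = true := by
  obtain ⟨h₁, h₂, h₃⟩ := hv
  have lit : ∀ l : Lit n m, evalLit σ (fun j => v (u (Sum.inr j))) l = true →
      eval v w (litForm u p l) = true := by
    rintro ⟨i | j, _ | _⟩ hl
    · have := h₂ i
      simp_all [evalLit, litForm, eval]
    · have := h₁ i
      simp_all [evalLit, litForm, eval]
    · have := h₃ j
      simp_all [evalLit, litForm, eval]
    · simpa [evalLit, litForm, eval] using hl
  rw [eval_dnfForm]
  simp only [evalDNF, List.any_eq_true, List.all_eq_true] at hψ ⊢
  obtain ⟨tm, htm, h⟩ := hψ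
  exact ⟨tm, htm, fun l hl => lit l (h l hl)⟩

end

/-- `Σ'` has a stable expansion iff `∃x₁⋯xₙ ∀y₁⋯yₘ ψ` is true. -/
theorem sigmaDNF_has_expansion_iff (n m : ℕ) (u p : Fin n ⊕ Fin m → ℕ)
    (hinj : Function.Injective (Sum.elim u p : (Fin n ⊕ Fin m) ⊕ (Fin n ⊕ Fin m) → ℕ))
    (ψ : DNF n m) :
    (∃ Δ : Set AE, IsStableExpansion (sigmaDNF u p ψ) Δ) ↔
    ∃ σ : Fin n → Bool, ∀ τ : Fin m → Bool, evalDNF σ τ ψ = true := by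
  rw [exists_isStableExpansion_iff]
  simp only [models_sigmaDNF_iff]
  constructor
  · rintro ⟨w, hw⟩
    have hψ : w (dnfForm u p ψ) = true := by
      by_contra h
      exact h ((hw _).2 fun v hv => absurd hv.1 h)
    simp only [hψ, true_and] at hw
    have hneg : (fun i => w (var (p (Sum.inl i)))) = fun i => !w (var (u (Sum.inl i))) := by
      funext i
      have := (hw (var (p (Sum.inl i)))).trans (forall_admissible_neg_iff hinj _ _ i)
      rw [Bool.eq_iff_iff, this, Bool.not_eq_true']
    rw [hneg] at hw
    refine ⟨fun i => w (var (u (Sum.inl i))), fun τ => ?_⟩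
    obtain ⟨v, hv, hlit⟩ := exists_literal_valuation hinj (fun i => w (var (u (Sum.inl i)))) τ
    have := (hw _).1 hψ v hv
    simp only [eval_dnfForm, hlit] at this
    exact this
  · rintro ⟨σ, hσ⟩
    obtain ⟨w, hw⟩ := exists_box_valuation (admissible u p σ fun i => !σ i)
    have hpos : (fun i => w (var (u (Sum.inl i)))) = σ := by
      funext i
      have := (hw (var (u (Sum.inl i)))).trans (forall_admissible_pos_iff hinj _ _ i)
      rw [Bool.eq_iff_iff, this, Bool.not_eq_false']
    have hneg : (fun i => w (var (p (Sum.inl i)))) = fun i => !σ i := by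
      funext i
      have := (hw (var (p (Sum.inl i)))).trans (forall_admissible_neg_iff hinj _ _ i)
      rw [Bool.eq_iff_iff, this, Bool.not_eq_true']
    have hψ : w (dnfForm u p ψ) = true :=
      (hw _).2 fun v hv => eval_dnfForm_of_admissible hv w (hσ _)
    refine ⟨w, fun φ => ?_⟩
    rw [hpos, hneg, hw φ]
    simp only [hψ, true_and]

end AE
end

section
/- Let Σ be a set of autoepistemic formulas each of which is built from propositional variables and the Boolean constants ⊤, ⊥ using only the unary connective negation ¬ and the modal operator L (i.e., Σ consists of autoepistemic N-formulas). Then Σ has at most one consistent stable expansion. -/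
namespace AE

/-- `N`-formulas: built from variables and `⊤, ⊥` using only `¬` and `L`. -/
def IsNFormula : AE → Prop
  | var _ => True
  | top => True
  | bot => True
  | neg φ => IsNFormula φ
  | box φ => IsNFormula φ
  | _ => False

/-- The truth value of an `N`-formula does not depend on the values of the `L`-atoms, or does not
depend on the values of the propositional variables. -/
theorem IsNFormula.eval_independent {φ : AE} (hφ : IsNFormula φ) :
    (∀ v w w', eval v w φ = eval v w' φ) ∨ (∀ v v' w, eval v w φ = eval v' w φ) := by
  induction φ with
  | var n => exact Or.inl fun _ _ _ => rfl
  | top => exact Or.inl fun _ _ _ => rfl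
  | bot => exact Or.inl fun _ _ _ => rfl
  | neg φ ih =>
    rcases ih hφ with h | h
    · exact Or.inl fun v w w' => congrArg Bool.not (h v w w')
    · exact Or.inr fun v v' w => congrArg Bool.not (h v v' w)
  | conj => exact hφ.elim
  | disj => exact hφ.elim
  | xor => exact hφ.elim
  | box => exact Or.inr fun _ _ _ => rfl

/-- Membership in a stable expansion is truth under all variable assignments that satisfy the
premises when `L` is read as membership in the expansion. -/
theorem IsStableExpansion.mem_iff {S Δ : Set AE} {w : AE → Bool} (h : IsStableExpansion S Δ)
    (hw : ∀ φ, w φ = true ↔ φ ∈ Δ) (φ : AE) :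
    φ ∈ Δ ↔ ∀ v, (∀ ψ ∈ S, eval v w ψ = true) → eval v w φ = true := by
  constructor
  · intro hφ v hv
    rw [h] at hφ
    refine hφ v w ?_
    rintro ψ ((hψ | ⟨χ, hχ, rfl⟩) | ⟨χ, hχ, rfl⟩)
    · exact hv ψ hψ
    · exact (hw χ).2 hχ
    · have := (hw χ).not.2 hχ
      simpa [eval] using this
  · intro hφ
    rw [h]
    intro v w' hw'
    obtain rfl : w' = w := by
      funext χ
      by_cases hχ : χ ∈ Δ
      · rw [(hw χ).2 hχ]
        exact hw' (box χ) (Or.inl (Or.inr ⟨χ, hχ, rfl⟩))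
      · have h₁ := hw' (neg (box χ)) (Or.inr ⟨χ, hχ, rfl⟩)
        have h₂ := (hw χ).not.2 hχ
        simp only [eval, Bool.not_eq_true'] at h₁
        rw [h₁, Bool.eq_false_iff.2 h₂]
    exact hφ v fun ψ hψ => hw' ψ (Or.inl (Or.inl hψ))

/-- A consistent stable expansion yields a variable assignment satisfying the premises. -/
theorem IsStableExpansion.exists_eval_eq_true {S Δ : Set AE} {w : AE → Bool}
    (h : IsStableExpansion S Δ) (hw : ∀ φ, w φ = true ↔ φ ∈ Δ) (hΔ : Δ ≠ Set.univ) :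
    ∃ v, ∀ ψ ∈ S, eval v w ψ = true := by
  by_contra! hv
  refine hΔ (Set.eq_univ_of_forall fun φ => (h.mem_iff hw φ).2 fun v hS => ?_)
  obtain ⟨ψ, hψ, hne⟩ := hv v
  exact (hne (hS ψ hψ)).elim

/-- If two `L`-valuations are both compatible with a set of `N`-formulas, the same variable
assignments satisfy the set under either of them. -/
theorem forall_eval_of_isNFormula {S : Set AE} (hS : ∀ φ ∈ S, IsNFormula φ) {w w' : AE → Bool}
    (hw' : ∃ v, ∀ ψ ∈ S, eval v w' ψ = true) {v : ℕ → Bool} (hv : ∀ ψ ∈ S, eval v w ψ = true) :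
    ∀ ψ ∈ S, eval v w' ψ = true := by
  obtain ⟨u, hu⟩ := hw'
  intro ψ hψ
  rcases (hS ψ hψ).eval_independent with h | h
  · exact (h v w' w).trans (hv ψ hψ)
  · exact (h v u w').trans (hu ψ hψ)

/-- A set of autoepistemic `N`-formulas has at most one consistent stable
expansion. -/
theorem N_at_most_one_consistent_expansion (S : Set AE)
    (hS : ∀ φ ∈ S, IsNFormula φ) :
    ∀ Δ₁ Δ₂ : Set AE, IsStableExpansion S Δ₁ → IsStableExpansion S Δ₂ →
      Δ₁ ≠ Set.univ → Δ₂ ≠ Set.univ → Δ₁ = Δ₂ := by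
  classical
  intro Δ₁ Δ₂ h₁ h₂ hc₁ hc₂
  obtain ⟨w₁, hw₁⟩ : ∃ w : AE → Bool, ∀ φ, w φ = true ↔ φ ∈ Δ₁ :=
    ⟨fun φ => decide (φ ∈ Δ₁), fun φ => decide_eq_true_iff⟩
  obtain ⟨w₂, hw₂⟩ : ∃ w : AE → Bool, ∀ φ, w φ = true ↔ φ ∈ Δ₂ :=
    ⟨fun φ => decide (φ ∈ Δ₂), fun φ => decide_eq_true_iff⟩
  have hV (v : ℕ → Bool) : (∀ ψ ∈ S, eval v w₁ ψ = true) ↔ ∀ ψ ∈ S, eval v w₂ ψ = true :=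
    ⟨forall_eval_of_isNFormula hS (h₂.exists_eval_eq_true hw₂ hc₂),
      forall_eval_of_isNFormula hS (h₁.exists_eval_eq_true hw₁ hc₁)⟩
  have hmem (φ : AE) (hφ : ∀ v, eval v w₁ φ = eval v w₂ φ) : φ ∈ Δ₁ ↔ φ ∈ Δ₂ := by
    rw [h₁.mem_iff hw₁, h₂.mem_iff hw₂]
    exact forall_congr' fun v => by rw [hV v, hφ v]
  have heval (φ : AE) : ∀ v, eval v w₁ φ = eval v w₂ φ := by
    induction φ with
    | box φ ih =>
      intro v
      exact Bool.eq_iff_iff.2 (((hw₁ φ).trans (hmem φ ih)).trans (hw₂ φ).symm)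
    | _ => simp_all [eval]
  exact Set.ext fun φ => hmem φ (heval φ)

end AE
end
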